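/- There is no finite group G with the following properties: p is a prime, G has a normal Sylow p-subgroup D which is abelian and non-cyclic, every nontrivial normal subgroup of G has order divisible by p (i.e. O_{p'}(G) = 1), G has exactly 5 conjugacy classes, and G has exactly 3 conjugacy classes consisting of p-regular elements. -/

import Mathlib

theorem aux_ncard {G : Type*} [Group G] (g : G) :
    (ConjClasses.mk g).carrier.ncard = (Subgroup.centralizer {g}).index := by
  rw [← ConjAct.orbit_eq_carrier_conjClasses, ← MulAction.index_stabilizer,
    Subgroup.centralizer_eq_comap_stabilizer]
  exact (Subgroup.index_comap_of_surjective _ ConjAct.toConjAct.surjective).symm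

theorem aux_arith {n a b : ℕ} (h : n = 1 + a + b) (ha : a ∣ n) (hb : b ∣ n) (hn : n ≠ 4) :
    n = 3 ∨ n = 6 := by
  wlog hab : b ≤ a generalizing a b
  · exact this (by omega) hb ha (by omega)
  obtain ⟨k, hk⟩ := ha
  obtain ⟨l, hl⟩ := hb
  have ha0 : 0 < a := by
    rcases Nat.eq_zero_or_pos a with h0 | h0
    · subst h0; omega
    · exact h0
  have hb0 : 0 < b := by
    rcases Nat.eq_zero_or_pos b with h0 | h0
    · subst h0; omega
    · exact h0
  have hk1 : 2 ≤ k := by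
    by_contra hc
    have : k = 0 ∨ k = 1 := by omega
    rcases this with rfl | rfl <;> omega
  rcases Nat.lt_or_ge k 3 with h3 | h3
  · have : k = 2 := by omega
    subst this
    have h4 : a = b + 1 := by omega
    have h5 : b ∣ 2 := by
      refine (Nat.dvd_add_right (Dvd.intro 2 rfl : b ∣ b * 2)).1 ?_
      exact ⟨l, by omega⟩
    have := Nat.le_of_dvd (by norm_num) h5
    omega
  · have : a * 3 ≤ a * k := Nat.mul_le_mul_left _ h3
    omega

theorem aux_class {Q : Type*} [Group Q] [Finite Q] (h : Nat.card (ConjClasses Q) ≤ 3) :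
    Nat.card Q = 1 ∨ Nat.card Q = 2 ∨ Nat.card Q = 3 ∨ Nat.card Q = 6 := by
  classical
  have hsum := Group.sum_card_conj_classes_eq_card Q
  have : Fintype (ConjClasses Q) := Fintype.ofFinite _
  rw [finsum_eq_sum_of_fintype] at hsum
  have h1 : (ConjClasses.mk (1 : Q)).carrier.ncard = 1 := by
    rw [aux_ncard]
    rw [Subgroup.index_eq_one, Subgroup.eq_top_iff']
    intro x
    simp [Subgroup.mem_centralizer_singleton_iff]
  have hd : ∀ c : ConjClasses Q, c.carrier.ncard ∣ Nat.card Q := by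
    intro c
    obtain ⟨g, rfl⟩ := c.exists_rep
    rw [aux_ncard]
    exact Subgroup.index_dvd_card _
  rw [← Finset.add_sum_erase _ _ (Finset.mem_univ (ConjClasses.mk (1 : Q))), h1] at hsum
  have h4 : Nat.card Q ≠ 4 := by
    intro h4
    have : Fact (Nat.Prime 2) := ⟨Nat.prime_two⟩
    have hc := IsPGroup.isMulCommutative_of_card_eq_prime_sq (G := Q) (p := 2) (by rw [h4]; norm_num)
    have hinj : Function.Injective (ConjClasses.mk : Q → ConjClasses Q) := by
      intro a b hab
      rw [ConjClasses.mk_eq_mk_iff_isConj, isConj_iff] at hab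
      obtain ⟨c, hc'⟩ := hab
      rw [← hc', hc.is_comm.comm c a]; simp
    have := Nat.card_le_card_of_injective _ hinj
    omega
  have hcard : (Finset.univ.erase (ConjClasses.mk (1 : Q))).card ≤ 2 := by
    rw [Finset.card_erase_of_mem (Finset.mem_univ _), Finset.card_univ,
      ← Nat.card_eq_fintype_card]
    omega
  generalize Finset.univ.erase (ConjClasses.mk (1 : Q)) = S at hsum hcard
  have : S.card = 0 ∨ S.card = 1 ∨ S.card = 2 := by omega
  rcases this with h0 | h0 | h0
  · rw [Finset.card_eq_zero] at h0
    subst h0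
    left; simpa using hsum.symm
  · rw [Finset.card_eq_one] at h0
    obtain ⟨a, rfl⟩ := h0
    rw [Finset.sum_singleton] at hsum
    have := hd a
    rw [← hsum, Nat.dvd_add_left dvd_rfl, Nat.dvd_one] at this
    omega
  · rw [Finset.card_eq_two] at h0
    obtain ⟨a, b, hab, rfl⟩ := h0
    rw [Finset.sum_pair hab] at hsum
    have := aux_arith (n := Nat.card Q) (by omega) (hd a) (hd b) h4
    omega

/-- There is no finite group `G` with a normal, abelian, non-cyclic Sylow `p`-subgroup `D`,
with `O_{p'}(G) = 1`, having exactly `5` conjugacy classes and exactly `3` conjugacy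
classes of `p`-regular elements. -/
theorem stmt_9 {p : ℕ} (hp : p.Prime) {G : Type*} [Group G] [Fintype G]
    (D : Subgroup G)
    (hDn : D.Normal)
    (hDpgrp : IsPGroup p D)
    (hDsyl : ¬ p ∣ D.index)
    (hab : ∀ a ∈ D, ∀ b ∈ D, a * b = b * a)
    (hcyc : ¬ IsCyclic D)
    (hOp' : ∀ N : Subgroup G, N.Normal → N ≠ ⊥ → p ∣ Nat.card N)
    (hk : Nat.card (ConjClasses G) = 5)
    (hl : Nat.card {c : ConjClasses G // ∀ g ∈ c.carrier, ¬ p ∣ orderOf g} = 3) :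
    False := by
  classical
  have : Fact p.Prime := ⟨hp⟩
  have hind0 : D.index ≠ 0 := Subgroup.index_ne_zero_of_finite
  obtain ⟨k, hDk⟩ := IsPGroup.iff_card.1 hDpgrp
  have hcop : Nat.Coprime (p ^ k) D.index := Nat.Coprime.pow_left _ ((Nat.Prime.coprime_iff_not_dvd hp).2 hDsyl)
  have hGcard : p ^ k * D.index = Nat.card G := by rw [← hDk]; exact D.card_mul_index
  -- size of the quotient
  have hQ : Nat.card (ConjClasses (G ⧸ D)) ≤ 3 := by
    rw [← hl]
    refine Nat.card_le_card_of_surjective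
      (fun c => ConjClasses.map (QuotientGroup.mk' D) c.1) ?_
    intro c
    obtain ⟨q, rfl⟩ := c.exists_rep
    obtain ⟨g, rfl⟩ := QuotientGroup.mk'_surjective D q
    obtain ⟨t, ht⟩ : ∃ t : ℕ, p ^ k * t ≡ 1 [MOD D.index] := by
      obtain ⟨m, hm⟩ := Nat.chineseRemainder hcop 0 1
      obtain ⟨t, rfl⟩ := (Nat.modEq_zero_iff_dvd).1 hm.1
      exact ⟨t, hm.2⟩
    have hord : ∀ x ∈ (ConjClasses.mk (g ^ (p ^ k * t))).carrier, ¬ p ∣ orderOf x := by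
      intro x hx hpx
      apply hDsyl
      refine hpx.trans (orderOf_dvd_of_pow_eq_one ?_)
      rw [ConjClasses.mem_carrier_iff_mk_eq, ConjClasses.mk_eq_mk_iff_isConj] at hx
      have h1 := hx.pow D.index
      rw [← pow_mul, show p ^ k * t * D.index = Nat.card G * t by rw [← hGcard]; ring,
        pow_mul, pow_card_eq_one', one_pow] at h1
      exact isConj_one_left.1 h1
    refine ⟨⟨_, hord⟩, ?_⟩
    change ConjClasses.mk (QuotientGroup.mk' D (g ^ (p ^ k * t))) = _
    congr 1
    rw [map_pow]
    conv_rhs => rw [← pow_one (QuotientGroup.mk' D g)]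
    rw [pow_eq_pow_iff_modEq]
    exact ht.of_dvd (orderOf_dvd_natCard _)
  have hQ' := aux_class hQ
  rw [← Subgroup.index_eq_card] at hQ'
  -- singular classes
  have hsing : Nat.card {c : ConjClasses G // ¬ ∀ g ∈ c.carrier, ¬ p ∣ orderOf g} = 2 := by
    have h1 := Nat.card_congr
      (Equiv.sumCompl (fun c : ConjClasses G => ∀ g ∈ c.carrier, ¬ p ∣ orderOf g))
    rw [Nat.card_sum, hl, hk] at h1
    omega
  obtain ⟨⟨s, hs⟩, ⟨t, ht⟩, hst, huniv⟩ := Nat.card_eq_two_iff.1 hsing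
  have hst : s ≠ t := fun h => hst (Subtype.ext h)
  have hcls : ∀ g : G, p ∣ orderOf g → ConjClasses.mk g = s ∨ ConjClasses.mk g = t := by
    intro g hg
    have : (⟨ConjClasses.mk g, fun h => h g ConjClasses.mem_carrier_mk hg⟩ :
      {c : ConjClasses G // ¬ ∀ g ∈ c.carrier, ¬ p ∣ orderOf g}) ∈ (Set.univ : Set _) := trivial
    rw [← huniv] at this
    simpa using this
  have hDord : ∀ x ∈ D, x ≠ 1 → p ∣ orderOf x := by
    intro x hx hx1
    obtain ⟨j, hj⟩ := IsPGroup.iff_orderOf.1 hDpgrp ⟨x, hx⟩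
    rw [Subgroup.orderOf_mk] at hj
    rw [hj]
    refine dvd_pow_self _ ?_
    rintro rfl
    exact hx1 (by simpa using hj)
  have hcent : ∀ x ∈ D, D ≤ Subgroup.centralizer {x} := by
    intro x hx y hy
    rw [Subgroup.mem_centralizer_singleton_iff]
    exact hab _ hy _ hx
  have hsub : ∀ x ∈ D, (ConjClasses.mk x).carrier ⊆ D := by
    intro x hx y hy
    rw [ConjClasses.mem_carrier_iff_mk_eq, ConjClasses.mk_eq_mk_iff_isConj] at hy
    obtain ⟨c, hc⟩ := isConj_iff.1 hy.symm
    rw [← hc]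
    exact hDn.conj_mem _ hx _
  have hinter : ∀ c : ConjClasses G, c.carrier ∩ D = ∅ ∨
      (c.carrier ∩ D).ncard ∣ D.index := by
    intro c
    rcases Set.eq_empty_or_nonempty (c.carrier ∩ (D : Set G)) with h | ⟨x, hx, hxD⟩
    · exact Or.inl h
    · right
      rw [ConjClasses.mem_carrier_iff_mk_eq] at hx
      subst hx
      rw [Set.inter_eq_left.2 (hsub x hxD), aux_ncard]
      exact Subgroup.index_dvd_of_le (hcent x hxD)
  have hone : ∀ c : ConjClasses G, (¬ ∀ g ∈ c.carrier, ¬ p ∣ orderOf g) → (1 : G) ∉ c.carrier := by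
    intro c hc h1
    rw [ConjClasses.mem_carrier_iff_mk_eq] at h1
    subst h1
    apply hc
    intro g hg
    rw [ConjClasses.mem_carrier_iff_mk_eq, ConjClasses.mk_eq_mk_iff_isConj,
      isConj_one_left] at hg
    rw [hg, orderOf_one]
    exact hp.one_lt.ne' ∘ Nat.dvd_one.1
  have hDset : (D : Set G) = insert 1 ((s.carrier ∩ D) ∪ (t.carrier ∩ D)) := by
    ext x
    simp only [Set.mem_insert_iff, Set.mem_union, Set.mem_inter_iff, SetLike.mem_coe]
    constructor
    · intro hx
      by_cases hx1 : x = 1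
      · exact Or.inl hx1
      · rw [ConjClasses.mem_carrier_iff_mk_eq, ConjClasses.mem_carrier_iff_mk_eq]
        have := hcls x (hDord x hx hx1)
        tauto
    · rintro (rfl | h | h)
      · exact D.one_mem
      · exact h.2
      · exact h.2
  have hDcard : Nat.card D = (s.carrier ∩ D).ncard + (t.carrier ∩ D).ncard + 1 := by
    have h1 : Nat.card D = (D : Set G).ncard := Nat.card_coe_set_eq _
    rw [h1]
    conv_lhs => rw [hDset]
    rw [Set.ncard_insert_of_notMem, Set.ncard_union_eq]
    · rw [Set.disjoint_left]
      rintro x ⟨hx, -⟩ ⟨hx', -⟩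
      rw [ConjClasses.mem_carrier_iff_mk_eq] at hx hx'
      exact hst (hx.symm.trans hx')
    · rintro (h | h)
      · exact hone s hs h.1
      · exact hone t ht h.1
  have hk2 : 2 ≤ k := by
    by_contra hc
    have : k = 0 ∨ k = 1 := by omega
    rcases this with rfl | rfl
    · apply hcyc
      have : Subsingleton D := (Nat.card_eq_one_iff_unique.1 (by simpa using hDk)).1
      infer_instance
    · exact hcyc (isCyclic_of_prime_card (p := p) (by simpa using hDk))
  have hp2 : p ^ 2 ≤ p ^ k := Nat.pow_le_pow_right hp.pos hk2
  have hle : ∀ c : ConjClasses G, (c.carrier ∩ D).ncard ≤ D.index := by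
    intro c
    rcases hinter c with h | h
    · rw [h]; simp
    · exact Nat.le_of_dvd (Nat.pos_of_ne_zero hind0) h
  have hles := hle s
  have hlet := hle t
  have hp2' := hp.two_le
  -- the finishing argument when `D.index = 3`, `|D| = 4`
  have key : ∀ s t : ConjClasses G, (¬ ∀ g ∈ t.carrier, ¬ p ∣ orderOf g) → D.index = 3 → p ≠ 3 →
      (s.carrier ∩ D).ncard = 3 → (t.carrier ∩ D) = ∅ →
      (D : Set G) = insert 1 ((s.carrier ∩ D) ∪ (t.carrier ∩ D)) → False := by
    intro s t ht h3 hp3 hs3 htD hDs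
    push Not at ht
    obtain ⟨g, hgt, hpg⟩ := ht
    have hgD : g ∉ D := fun h => by
      have : g ∈ t.carrier ∩ (D : Set G) := ⟨hgt, h⟩
      rw [htD] at this
      exact this
    have hg3 : g ^ 3 ∈ D := by
      rw [← h3]; exact D.pow_index_mem g
    have hg1 : g ^ 3 ≠ 1 := by
      intro h
      have h' := hpg.trans (orderOf_dvd_of_pow_eq_one h)
      exact hp3 ((Nat.prime_dvd_prime_iff_eq hp Nat.prime_three).1 h')
    have hmem : g ^ 3 ∈ (D : Set G) := hg3
    rw [hDs, htD, Set.union_empty] at hmem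
    rcases hmem with h | ⟨h, -⟩
    · exact hg1 h
    rw [ConjClasses.mem_carrier_iff_mk_eq] at h
    rw [← h, Set.inter_eq_left.2 (hsub _ hg3), aux_ncard] at hs3
    have hrel := Subgroup.relIndex_mul_index (hcent _ hg3)
    rw [hs3, h3] at hrel
    have hrel1 : D.relIndex (Subgroup.centralizer {g ^ 3}) = 1 := by omega
    rw [Subgroup.relIndex_eq_one] at hrel1
    apply hgD
    apply hrel1
    rw [Subgroup.mem_centralizer_singleton_iff]
    exact (pow_succ' g 3).symm.trans (pow_succ g 3)
  rcases hQ' with h | h | h | h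
  · have : 2 ^ 2 ≤ p ^ 2 := Nat.pow_le_pow_left hp2' 2
    omega
  · have : p ≠ 2 := by rintro rfl; exact hDsyl (by rw [h])
    have : 3 ^ 2 ≤ p ^ 2 := Nat.pow_le_pow_left (by omega) 2
    omega
  · have hp3 : p ≠ 3 := by rintro rfl; exact hDsyl (by rw [h])
    have hpe : p = 2 := by
      by_contra hne
      have : 3 ^ 2 ≤ p ^ 2 := Nat.pow_le_pow_left (by omega) 2
      omega
    have hk' : k = 2 := by
      by_contra hne
      have : 2 ^ 3 ≤ p ^ k := by rw [hpe]; exact Nat.pow_le_pow_right (by norm_num) (by omega)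
      omega
    rw [hk', hpe] at hDk
    have hvals : ∀ c : ConjClasses G, c.carrier ∩ D = ∅ ∨ (c.carrier ∩ D).ncard = 1 ∨
        (c.carrier ∩ D).ncard = 3 := by
      intro c
      rcases hinter c with h' | h'
      · exact Or.inl h'
      · rw [h, Nat.dvd_prime Nat.prime_three] at h'
        exact Or.inr h'
    rcases hvals s with h1 | h1 | h1 <;> rcases hvals t with h2 | h2 | h2
    · rw [h1, h2, Set.ncard_empty] at hDcard; omega
    · rw [h1, h2, Set.ncard_empty] at hDcard; omega
    · exact key t s hs h hp3 h2 h1 (by rw [Set.union_comm]; exact hDset)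
    · rw [h1, h2, Set.ncard_empty] at hDcard; omega
    · omega
    · omega
    · exact key s t ht h hp3 h1 h2 hDset
    · omega
    · omega
  · have h2 : p ≠ 2 := by rintro rfl; exact hDsyl (by rw [h]; norm_num)
    have h3 : p ≠ 3 := by rintro rfl; exact hDsyl (by rw [h]; norm_num)
    have h4 : p ≠ 4 := by rintro rfl; exact absurd hp (by norm_num)
    have : 5 ^ 2 ≤ p ^ 2 := Nat.pow_le_pow_left (by omega) 2
    omega
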